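/- Let G = (V,E) be a finite simple graph with n vertices and c connected components, let 0 < q₀ < 1, and let v : E → ℝ satisfy −1 − √(1−q₀) < v_e < −q₀ for all e ∈ E. Then for every integer 0 ≤ ℓ ≤ n − c, the ℓ-th derivative of the function q ↦ Z_G(q,v)/q^c, evaluated at q = q₀, satisfies (−1)^{n−c−ℓ} · (d^ℓ/dq^ℓ)(Z_G(q,v)/q^c)|_{q=q₀} > 0. -/

import Mathlib

open Finset

/-- The number of connected components of the spanning subgraph of a finite graph
with edge set `A`. -/
noncomputable def numCompOfEdges {V : Type*} [Fintype V] (A : Finset (Sym2 V)) : ℕ :=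
  Nat.card (SimpleGraph.fromEdgeSet (A : Set (Sym2 V))).ConnectedComponent

/-- The multivariate Tutte polynomial `Z_G(q, v) = ∑_{A ⊆ E} q^{k(A)} ∏_{e ∈ A} v_e`. -/
noncomputable def tutteZ {V : Type*} [Fintype V] [DecidableEq V] (G : SimpleGraph V)
    [DecidableRel G.Adj] (q : ℝ) (v : Sym2 V → ℝ) : ℝ :=
  ∑ A ∈ G.edgeFinset.powerset, q ^ numCompOfEdges A * ∏ e ∈ A, v e

open Polynomial in
/-- The Tutte sum of the contraction by `C` restricted to `S`, for an abstract
component-counting function `k`, divided by the `m`-th power of the variable and expanded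
around `q₀`. -/
noncomputable def shiftedTutte {α : Type*} [DecidableEq α] (k : Finset α → ℕ) (q₀ : ℝ) (m : ℕ)
    (C S : Finset α) (v : α → ℝ) : ℝ[X] :=
  ∑ A ∈ S.powerset, (X + Polynomial.C q₀) ^ (k (C ∪ A) - m) * Polynomial.C (∏ e ∈ A, v e)

section ShiftedTutte

open Polynomial

variable {α : Type*} [DecidableEq α] {k : Finset α → ℕ} {q₀ : ℝ} {m : ℕ}

theorem shiftedTutte_empty (C : Finset α) (v : α → ℝ) :
    shiftedTutte k q₀ m C ∅ v = (X + Polynomial.C q₀) ^ (k C - m) := by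
  simp [shiftedTutte]

/-- Deletion-contraction. -/
theorem shiftedTutte_insert {e : α} {S : Finset α} (he : e ∉ S) (C : Finset α) (v : α → ℝ) :
    shiftedTutte k q₀ m C (insert e S) v =
      shiftedTutte k q₀ m C S v +
        Polynomial.C (v e) * shiftedTutte k q₀ m (insert e C) S v := by
  unfold shiftedTutte
  rw [Finset.sum_powerset_insert he, Finset.mul_sum]
  congr 1
  refine Finset.sum_congr rfl fun A hA => ?_
  have heA : e ∉ A := fun h => he (Finset.mem_powerset.1 hA h)
  rw [Finset.prod_insert heA, Finset.union_insert, Finset.insert_union, Polynomial.C_mul]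
  ring

theorem shiftedTutte_congr_weight {C S : Finset α} {v w : α → ℝ} (h : ∀ e ∈ S, v e = w e) :
    shiftedTutte k q₀ m C S v = shiftedTutte k q₀ m C S w := by
  refine Finset.sum_congr rfl fun A hA => ?_
  rw [Finset.prod_congr rfl fun e he => h e (Finset.mem_powerset.1 hA he)]

theorem shiftedTutte_congr_contraction {C D S : Finset α} {v : α → ℝ}
    (h : ∀ A ⊆ S, k (C ∪ A) = k (D ∪ A)) :
    shiftedTutte k q₀ m C S v = shiftedTutte k q₀ m D S v := by
  refine Finset.sum_congr rfl fun A hA => ?_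
  rw [h A (Finset.mem_powerset.1 hA)]

theorem shiftedTutte_bridge {C D S : Finset α} {v : α → ℝ}
    (h : ∀ A ⊆ S, k (C ∪ A) = k (D ∪ A) + 1) (hm : ∀ A ⊆ S, m ≤ k (D ∪ A)) :
    shiftedTutte k q₀ m C S v = (X + Polynomial.C q₀) * shiftedTutte k q₀ m D S v := by
  unfold shiftedTutte
  rw [Finset.mul_sum]
  refine Finset.sum_congr rfl fun A hA => ?_
  have hA := Finset.mem_powerset.1 hA
  rw [h A hA, Nat.sub_add_comm (hm A hA), pow_succ]
  ring

/-- The coefficients of `p` alternate in sign, the one of index `r` being nonnegative, and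
those of index at most `r` do not vanish. -/
def AlternatesBelow (r : ℕ) (p : ℝ[X]) : Prop :=
  (∀ l, 0 ≤ (-1) ^ (r + l) * p.coeff l) ∧ ∀ l ≤ r, 0 < (-1) ^ (r + l) * p.coeff l

theorem AlternatesBelow.one : AlternatesBelow 0 1 := by
  refine ⟨fun l => ?_, fun l hl => ?_⟩
  · rcases l with _ | l <;> simp [coeff_one]
  · obtain rfl : l = 0 := by omega
    simp

theorem AlternatesBelow.add_C_mul {r : ℕ} {p s : ℝ[X]} {a : ℝ} (ha : a < 0)
    (hp : AlternatesBelow (r + 1) p) (hs : AlternatesBelow r s) :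
    AlternatesBelow (r + 1) (p + Polynomial.C a * s) := by
  have key (l : ℕ) : (-1 : ℝ) ^ (r + 1 + l) * (p + Polynomial.C a * s).coeff l =
      (-1) ^ (r + 1 + l) * p.coeff l + -a * ((-1) ^ (r + l) * s.coeff l) := by
    rw [coeff_add, coeff_C_mul]
    ring
  have hnn (l : ℕ) : 0 ≤ -a * ((-1) ^ (r + l) * s.coeff l) :=
    mul_nonneg (by linarith) (hs.1 l)
  refine ⟨fun l => ?_, fun l hl => ?_⟩
  · rw [key]
    exact add_nonneg (hp.1 l) (hnn l)
  · rw [key]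
    exact add_pos_of_pos_of_nonneg (hp.2 l hl) (hnn l)

theorem AlternatesBelow.linear_mul {r : ℕ} {p : ℝ[X]} {a : ℝ} (ha : a < 0)
    (hp : AlternatesBelow r p) : AlternatesBelow (r + 1) ((X + Polynomial.C a) * p) := by
  have key0 : (-1 : ℝ) ^ (r + 1 + 0) * ((X + Polynomial.C a) * p).coeff 0 =
      -a * ((-1) ^ (r + 0) * p.coeff 0) := by
    rw [add_mul, coeff_add, coeff_C_mul, coeff_X_mul_zero]
    ring
  have key (l : ℕ) : (-1 : ℝ) ^ (r + 1 + (l + 1)) * ((X + Polynomial.C a) * p).coeff (l + 1) =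
      (-1) ^ (r + l) * p.coeff l + -a * ((-1) ^ (r + (l + 1)) * p.coeff (l + 1)) := by
    rw [add_mul, coeff_add, coeff_C_mul, coeff_X_mul]
    ring
  have hnn (l : ℕ) : 0 ≤ -a * ((-1) ^ (r + l) * p.coeff l) :=
    mul_nonneg (by linarith) (hp.1 l)
  refine ⟨fun l => ?_, fun l hl => ?_⟩
  · rcases l with _ | l
    · rw [key0]
      exact hnn 0
    · rw [key]
      exact add_nonneg (hp.1 l) (hnn _)
  · rcases l with _ | l
    · rw [key0]
      exact mul_pos (by linarith) (hp.2 0 (Nat.zero_le r))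
    · rw [key]
      exact add_pos_of_pos_of_nonneg (hp.2 l (by omega)) (hnn _)

/-- The admissible interval of weights is stable under merging parallel edges. -/
theorem parallel_weight_bounds {q₀ a b : ℝ} (hq0 : 0 < q₀) (hq1 : q₀ < 1)
    (ha : -1 - √(1 - q₀) < a ∧ a < -q₀) (hb : -1 - √(1 - q₀) < b ∧ b < -q₀) :
    -1 - √(1 - q₀) < a + b + a * b ∧ a + b + a * b < -q₀ := by
  obtain ⟨t, ht⟩ : ∃ t, t = √(1 - q₀) := ⟨_, rfl⟩
  have ht0 : 0 < t := ht ▸ Real.sqrt_pos.2 (by linarith)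
  have hts : t ^ 2 = 1 - q₀ := by rw [ht, Real.sq_sqrt (by linarith)]
  rw [← ht] at ha hb ⊢
  have ht1 : t < 1 := by nlinarith
  have htt : t ^ 2 < t := by nlinarith
  have hua : |1 + a| < t := abs_lt.2 ⟨by linarith, by linarith⟩
  have hub : |1 + b| < t := abs_lt.2 ⟨by linarith, by linarith⟩
  have hab : |(1 + a) * (1 + b)| < t ^ 2 := by
    rw [abs_mul, sq]
    exact mul_lt_mul'' hua hub (abs_nonneg _) (abs_nonneg _)
  obtain ⟨h1, h2⟩ := abs_lt.1 hab
  constructor <;> linarith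

theorem alternatesBelow_shiftedTutte (hq0 : 0 < q₀) (hq1 : q₀ < 1) (hanti : Antitone k)
    (hstep : ∀ A e, k A ≤ k (insert e A) + 1)
    (hloop : ∀ A B e, A ⊆ B → k (insert e A) = k A → k (insert e B) = k B)
    (S : Finset α) (C : Finset α) (v : α → ℝ)
    (hS : ∀ e ∈ S, k (insert e C) ≠ k C)
    (hv : ∀ e ∈ S, -1 - √(1 - q₀) < v e ∧ v e < -q₀) :
    AlternatesBelow (k C - k (C ∪ S)) (shiftedTutte k q₀ (k (C ∪ S)) C S v) := by
  induction S using Finset.strongInduction generalizing C v with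
  | H S ih =>
  have hdrop (A : Finset α) (e : α) (h : k (insert e A) ≠ k A) : k A = k (insert e A) + 1 := by
    have h1 := hanti (Finset.subset_insert e A)
    have h2 := hstep A e
    omega
  rcases S.eq_empty_or_nonempty with rfl | ⟨e, heS⟩
  · simpa [shiftedTutte_empty] using AlternatesBelow.one
  obtain ⟨S, heS', rfl⟩ : ∃ T, e ∉ T ∧ insert e T = S :=
    ⟨S.erase e, Finset.notMem_erase _ _, Finset.insert_erase heS⟩
  have hCe := hdrop C e (hS e heS)
  by_cases hpar : ∃ f ∈ S, k (insert f (insert e C)) = k (insert e C)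
  · obtain ⟨f, hfS, hf⟩ := hpar
    obtain ⟨S, hfS', rfl⟩ : ∃ T, f ∉ T ∧ insert f T = S :=
      ⟨S.erase f, Finset.notMem_erase _ _, Finset.insert_erase hfS⟩
    have heS0 : e ∉ S := fun h => heS' (Finset.mem_insert_of_mem h)
    have hef : e ≠ f := fun h => heS' (h ▸ Finset.mem_insert_self _ _)
    have hCf := hdrop C f (hS f (by simp))
    have hf' : k (insert e (insert f C)) = k (insert f C) := by
      rw [Finset.insert_comm]
      omega
    have h1 (A : Finset α) : k (insert f (insert e C) ∪ A) = k (insert e C ∪ A) := by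
      rw [Finset.insert_union]
      exact hloop _ _ f Finset.subset_union_left hf
    have h2 (A : Finset α) : k (insert f C ∪ A) = k (insert e C ∪ A) := by
      rw [← h1, Finset.insert_comm, Finset.insert_union e]
      exact (hloop _ _ e Finset.subset_union_left hf').symm
    set w := Function.update v e (v e + v f + v e * v f) with hw
    have hwe : w e = v e + v f + v e * v f := by simp [hw]
    have hwS : ∀ x ∈ S, v x = w x := fun x hx => by
      rw [hw, Function.update_of_ne]
      rintro rfl
      exact heS0 hx
    have hk : k (C ∪ insert e (insert f S)) = k (C ∪ insert e S) := by
      have := h1 S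
      rwa [Finset.insert_union, Finset.insert_union, ← Finset.union_insert,
        ← Finset.union_insert, Finset.insert_comm] at this
    have hT : shiftedTutte k q₀ (k (C ∪ insert e S)) C (insert e (insert f S)) v =
        shiftedTutte k q₀ (k (C ∪ insert e S)) C (insert e S) w := by
      rw [shiftedTutte_insert heS', shiftedTutte_insert hfS', shiftedTutte_insert hfS',
        shiftedTutte_insert heS0, hwe, shiftedTutte_congr_contraction fun A _ => h1 A,
        shiftedTutte_congr_contraction fun A _ => h2 A, shiftedTutte_congr_weight hwS,
        shiftedTutte_congr_weight hwS]
      simp only [Polynomial.C_add, Polynomial.C_mul]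
      ring
    rw [hk, hT]
    refine ih _ ?_ C w (fun x hx => hS x ?_) fun x hx => ?_
    · rw [Finset.insert_comm]
      exact Finset.ssubset_insert (by simp [hef.symm, hfS'])
    · rw [Finset.insert_comm]
      exact Finset.mem_insert_of_mem hx
    · rcases Finset.mem_insert.1 hx with rfl | hx
      · rw [hwe]
        exact parallel_weight_bounds hq0 hq1 (hv _ heS) (hv f (by simp))
      · rw [← hwS x hx]
        exact hv x (by simp [hx])
  · push Not at hpar
    have hve := (hv e heS).2
    have hS' : ∀ x ∈ S, -1 - √(1 - q₀) < v x ∧ v x < -q₀ :=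
      fun x hx => hv x (Finset.mem_insert_of_mem hx)
    have hcon := ih S (Finset.ssubset_insert heS') (insert e C) v hpar hS'
    have hu : insert e C ∪ S = C ∪ insert e S := by
      rw [Finset.insert_union, Finset.union_insert]
    rw [hu] at hcon
    have hle : k (C ∪ insert e S) ≤ k (insert e C) := hu ▸ hanti Finset.subset_union_left
    have hr : k C - k (C ∪ insert e S) = k (insert e C) - k (C ∪ insert e S) + 1 := by omega
    rw [shiftedTutte_insert heS', hr]
    by_cases hb : k (C ∪ insert e S) = k (C ∪ S)
    · have hdel := ih S (Finset.ssubset_insert heS') C v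
        (fun x hx => hS x (Finset.mem_insert_of_mem hx)) hS'
      rw [← hb, hr] at hdel
      exact hdel.add_C_mul (by linarith) hcon
    · rw [shiftedTutte_bridge (D := insert e C), ← add_mul, add_assoc, ← Polynomial.C_add]
      · exact hcon.linear_mul (by linarith)
      · intro A hA
        rw [Finset.insert_union]
        refine hdrop _ _ fun h => hb ?_
        rw [Finset.union_insert]
        exact hloop _ _ e (Finset.union_subset_union_right hA) h
      · intro A hA
        rw [← hu]
        exact hanti (Finset.union_subset_union_right hA)

end ShiftedTutte

section NumComp

variable {V : Type*}

/-- The functions on the vertices that take equal values at the ends of each edge in `A`. -/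
def edgeInvariants (A : Finset (Sym2 V)) : Submodule ℝ (V → ℝ) where
  carrier := {x | ∀ i j, s(i, j) ∈ A → x i = x j}
  add_mem' hx hy i j h := by simp [hx i j h, hy i j h]
  zero_mem' _ _ _ := rfl
  smul_mem' a x hx i j h := by simp [hx i j h]

theorem edgeInvariants_antitone : Antitone (edgeInvariants (V := V)) :=
  fun _ _ hAB _ hx i j h => hx i j (hAB h)

theorem edgeInvariants_insert [DecidableEq V] (A : Finset (Sym2 V)) (i j : V) :
    edgeInvariants (insert s(i, j) A) = edgeInvariants A ⊓
      LinearMap.ker (LinearMap.proj (R := ℝ) (φ := fun _ : V => ℝ) i - LinearMap.proj j) := by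
  ext x
  simp only [Submodule.mem_inf, LinearMap.mem_ker, LinearMap.sub_apply, LinearMap.proj_apply,
    sub_eq_zero]
  constructor
  · exact fun h => ⟨fun a b hab => h a b (Finset.mem_insert_of_mem hab),
      h i j (Finset.mem_insert_self _ _)⟩
  · rintro ⟨h1, h2⟩ a b hab
    rcases Finset.mem_insert.1 hab with h | h
    · rcases Sym2.eq_iff.1 h with ⟨rfl, rfl⟩ | ⟨rfl, rfl⟩
      exacts [h2, h2.symm]
    · exact h1 a b h

variable [Fintype V]

theorem numCompOfEdges_eq_finrank (A : Finset (Sym2 V)) :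
    numCompOfEdges A = Module.finrank ℝ (edgeInvariants A) := by
  classical
  have hker : edgeInvariants A = LinearMap.ker (Matrix.toLin'
      ((SimpleGraph.fromEdgeSet (A : Set (Sym2 V))).lapMatrix ℝ)) := by
    ext x
    rw [LinearMap.mem_ker, Matrix.toLin'_apply,
      SimpleGraph.lapMatrix_mulVec_eq_zero_iff_forall_adj]
    refine ⟨fun h i j hij => h i j ?_, fun h i j hij => ?_⟩
    · exact ((SimpleGraph.fromEdgeSet_adj _).1 hij).1
    · by_cases hne : i = j
      · rw [hne]
      · exact h i j ((SimpleGraph.fromEdgeSet_adj _).2 ⟨hij, hne⟩)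
  rw [hker, ← SimpleGraph.card_connectedComponent_eq_finrank_ker_toLin'_lapMatrix,
    numCompOfEdges, Nat.card_eq_fintype_card]

theorem numCompOfEdges_antitone : Antitone (numCompOfEdges (V := V)) := fun A B hAB => by
  rw [numCompOfEdges_eq_finrank, numCompOfEdges_eq_finrank]
  exact Submodule.finrank_mono (edgeInvariants_antitone hAB)

theorem numCompOfEdges_empty : numCompOfEdges (∅ : Finset (Sym2 V)) = Fintype.card V := by
  have : edgeInvariants (∅ : Finset (Sym2 V)) = ⊤ :=
    eq_top_iff.2 fun x _ i j h => absurd h (Finset.notMem_empty _)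
  rw [numCompOfEdges_eq_finrank, this, finrank_top, Module.finrank_fintype_fun_eq_card]

variable [DecidableEq V]

theorem numCompOfEdges_le_insert (A : Finset (Sym2 V)) (e : Sym2 V) :
    numCompOfEdges A ≤ numCompOfEdges (insert e A) + 1 := by
  induction e with
  | _ i j =>
  rw [numCompOfEdges_eq_finrank, numCompOfEdges_eq_finrank, edgeInvariants_insert]
  set φ := LinearMap.proj (R := ℝ) (φ := fun _ : V => ℝ) i - LinearMap.proj j
  have h1 := Submodule.finrank_sup_add_finrank_inf_eq (edgeInvariants A) (LinearMap.ker φ)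
  have h2 := LinearMap.finrank_range_add_finrank_ker φ
  have h3 := Submodule.finrank_le (edgeInvariants A ⊔ LinearMap.ker φ)
  have h4 := Submodule.finrank_le (LinearMap.range φ)
  rw [Module.finrank_self] at h4
  omega

theorem numCompOfEdges_insert_eq_iff (A : Finset (Sym2 V)) (i j : V) :
    numCompOfEdges (insert s(i, j) A) = numCompOfEdges A ↔
      ∀ x ∈ edgeInvariants A, x i = x j := by
  rw [numCompOfEdges_eq_finrank, numCompOfEdges_eq_finrank]
  constructor
  · intro h x hx
    rw [← Submodule.eq_of_le_of_finrank_eq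
      (edgeInvariants_antitone (Finset.subset_insert s(i, j) A)) h] at hx
    exact hx i j (Finset.mem_insert_self _ _)
  · intro h
    rw [edgeInvariants_insert, inf_eq_left.2]
    intro x hx
    simpa [sub_eq_zero] using h x hx

theorem numCompOfEdges_insert_eq_of_subset (A B : Finset (Sym2 V)) (e : Sym2 V) (hAB : A ⊆ B)
    (h : numCompOfEdges (insert e A) = numCompOfEdges A) :
    numCompOfEdges (insert e B) = numCompOfEdges B := by
  induction e with
  | _ i j =>
  rw [numCompOfEdges_insert_eq_iff] at h ⊢
  exact fun x hx => h x (edgeInvariants_antitone hAB hx)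

theorem numCompOfEdges_singleton_ne {e : Sym2 V} (he : ¬ e.IsDiag) :
    numCompOfEdges (insert e ∅ : Finset (Sym2 V)) ≠ numCompOfEdges (∅ : Finset (Sym2 V)) := by
  induction e with
  | _ i j =>
  rw [Ne, numCompOfEdges_insert_eq_iff]
  intro h
  have := h (Pi.single i 1) fun _ _ h => absurd h (Finset.notMem_empty _)
  rw [Pi.single_eq_same, Pi.single_eq_of_ne fun hji => he (Sym2.mk_isDiag_iff.2 hji.symm)] at this
  exact one_ne_zero this

end NumComp

theorem Polynomial.iteratedDeriv_eval_eq (p : Polynomial ℝ) (l : ℕ) :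
    iteratedDeriv l (fun x => p.eval x) = fun x => (Polynomial.derivative^[l] p).eval x := by
  induction l with
  | zero => simp
  | succ l ih =>
    ext x
    rw [iteratedDeriv_succ, ih, Polynomial.deriv, Function.iterate_succ_apply']

open Polynomial in
theorem tutteZ_eq_eval_mul_pow {V : Type*} [Fintype V] [DecidableEq V] (G : SimpleGraph V)
    [DecidableRel G.Adj] (q q₀ : ℝ) (v : Sym2 V → ℝ) :
    tutteZ G q v = (shiftedTutte numCompOfEdges q₀ (numCompOfEdges G.edgeFinset) ∅
      G.edgeFinset v).eval (q - q₀) * q ^ numCompOfEdges G.edgeFinset := by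
  rw [tutteZ, shiftedTutte, eval_finsetSum, Finset.sum_mul]
  refine Finset.sum_congr rfl fun A hA => ?_
  have hle := numCompOfEdges_antitone (Finset.mem_powerset.1 hA)
  simp only [Finset.empty_union, eval_mul, eval_pow, eval_add, eval_X, eval_C, sub_add_cancel]
  rw [mul_right_comm, ← pow_add, Nat.sub_add_cancel hle]

/-- Let `G` be a finite simple graph with `n` vertices and `c` components, `0 < q₀ < 1`,
and suppose `-1 - √(1-q₀) < v_e < -q₀` for every edge `e`.  Then for `0 ≤ ℓ ≤ n - c`,
`(-1)^{n-c-ℓ} (d^ℓ/dq^ℓ)(Z_G(q,v)/q^c) |_{q=q₀} > 0`. -/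
theorem tutteZ_derivatives_sign {V : Type*} [Fintype V] [DecidableEq V]
    (G : SimpleGraph V) [DecidableRel G.Adj]
    (n c : ℕ) (hn : n = Fintype.card V) (hc : c = Nat.card G.ConnectedComponent)
    (q₀ : ℝ) (hq0 : 0 < q₀) (hq1 : q₀ < 1) (v : Sym2 V → ℝ)
    (hv : ∀ e ∈ G.edgeFinset, -1 - Real.sqrt (1 - q₀) < v e ∧ v e < -q₀)
    (ℓ : ℕ) (hℓ : ℓ ≤ n - c) :
    0 < (-1 : ℝ) ^ ((n : ℤ) - c - ℓ) *
      iteratedDeriv ℓ (fun q : ℝ => tutteZ G q v / q ^ c) q₀ := by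
  have hcE : c = numCompOfEdges G.edgeFinset := by
    rw [hc, numCompOfEdges, SimpleGraph.coe_edgeFinset, SimpleGraph.fromEdgeSet_edgeSet]
  have hn0 : n = numCompOfEdges (∅ : Finset (Sym2 V)) := by rw [hn, numCompOfEdges_empty]
  have hcn : c ≤ n := by
    rw [hcE, hn0]
    exact numCompOfEdges_antitone (Finset.empty_subset _)
  have halt := alternatesBelow_shiftedTutte hq0 hq1 numCompOfEdges_antitone
    numCompOfEdges_le_insert numCompOfEdges_insert_eq_of_subset G.edgeFinset ∅ v
    (fun e he => numCompOfEdges_singleton_ne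
      (G.not_isDiag_of_mem_edgeSet (SimpleGraph.mem_edgeFinset.1 he))) hv
  rw [Finset.empty_union, ← hn0, ← hcE] at halt
  set p := shiftedTutte numCompOfEdges q₀ c ∅ G.edgeFinset v
  have heq : (fun q : ℝ => tutteZ G q v / q ^ c) =ᶠ[nhds q₀] fun q => p.eval (q - q₀) := by
    filter_upwards [eventually_ne_nhds hq0.ne'] with q hq
    rw [tutteZ_eq_eval_mul_pow G q q₀, ← hcE, mul_div_cancel_right₀ _ (pow_ne_zero _ hq)]
  have hderiv : iteratedDeriv ℓ (fun q : ℝ => tutteZ G q v / q ^ c) q₀ =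
      ℓ.factorial * p.coeff ℓ := by
    rw [heq.iteratedDeriv_eq, iteratedDeriv_comp_sub_const ℓ (fun x => p.eval x) q₀,
      Polynomial.iteratedDeriv_eval_eq]
    simp [← Polynomial.coeff_zero_eq_eval_zero, Polynomial.coeff_iterate_derivative,
      Nat.descFactorial_self]
  have hexp : (n : ℤ) - c - ℓ = ((n - c - ℓ : ℕ) : ℤ) := by omega
  have hsign : (-1 : ℝ) ^ (n - c - ℓ) = (-1) ^ (n - c + ℓ) := by
    rw [show n - c + ℓ = n - c - ℓ + 2 * ℓ by omega, pow_add, pow_mul]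
    simp
  rw [hderiv, hexp, zpow_natCast, hsign, mul_left_comm]
  exact mul_pos (by exact_mod_cast ℓ.factorial_pos) (halt.2 ℓ hℓ)
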